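/- For every circuit C⃗_n of order n = k + x, with k ≥ 2, k even, 1 ≤ x ≤ k − 1, and (x, n) ∉ {(1,4), (1,6)}, the k-labeled packing number satisfies λ^k(C⃗_n) ≥ x + 1. -/

import Mathlib

/-- The arc set of the circuit (directed cycle) `C⃗_n`, whose vertex set is `ZMod n`
and whose arcs go from each vertex `v` to `v + 1`. -/
def circuitArcs (n : ℕ) : Set (ZMod n × ZMod n) :=
  {a | ∃ v : ZMod n, a = (v, v + 1)}

/-- The `k` bijections `σ 1, …, σ k` from the vertices of `C⃗_n` to the vertices of the
complete digraph `↔K_n` form a `k`-placement of `C⃗_n`: the images of the arcs of `C⃗_n`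
are arcs of `↔K_n` (they join distinct vertices), and the images of the arc set of
`C⃗_n` under the `σ i` are pairwise disjoint. -/
def IsDirPlacement (n k : ℕ) (σ : Fin k → (ZMod n ≃ ZMod n)) : Prop :=
  (∀ i : Fin k, ∀ a ∈ circuitArcs n, σ i a.1 ≠ σ i a.2) ∧
  (∀ i j : Fin k, i ≠ j →
    Disjoint ((fun a => (σ i a.1, σ i a.2)) '' circuitArcs n)
      ((fun a => (σ j a.1, σ j a.2)) '' circuitArcs n))

/-- `f`, a labeling of the `n` vertices of `↔K_n` using exactly `p` distinct labels
(i.e. a surjection onto `Fin p`), together with `k` bijections `σ 1, …, σ k`, is a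
`p`-labeled packing of `k` copies of `C⃗_n` into `↔K_n`: the `σ i` form a `k`-placement
of `C⃗_n` and, for every vertex `v` of `C⃗_n`, all the images `σ i v` carry the same
label. -/
def IsDirLabeledPacking (n k p : ℕ) (f : ZMod n → Fin p)
    (σ : Fin k → (ZMod n ≃ ZMod n)) : Prop :=
  Function.Surjective f ∧ IsDirPlacement n k σ ∧
  (∀ i j : Fin k, ∀ v : ZMod n, f (σ i v) = f (σ j v))

/-- The `k`-labeled packing number `λ^k(C⃗_n)`: the largest `p` such that there is a
`p`-labeled packing of `k` copies of `C⃗_n` into `↔K_n`. -/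
noncomputable def dirLabeledPackingNumber (n k : ℕ) : ℕ :=
  sSup {p | ∃ f σ, IsDirLabeledPacking n k p f σ}

/-- The zigzag sequence `0, -1, 1, -2, 2, …`. -/
def zigzag (j : ℕ) : ℤ :=
  if j % 2 = 0 then (j / 2 : ℕ) else -((j / 2 : ℕ) : ℤ) - 1

theorem zigzag_cast_injOn {k a b : ℕ} (ha : a < k) (hb : b < k)
    (h : (zigzag a : ZMod k) = zigzag b) : a = b := by
  rw [ZMod.intCast_eq_intCast_iff_dvd_sub] at h
  have h0 : zigzag b - zigzag a = 0 := by
    refine Int.eq_zero_of_abs_lt_dvd h ?_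
    rw [abs_lt]
    unfold zigzag
    split_ifs <;> constructor <;> omega
  unfold zigzag at h0
  split_ifs at h0 <;> omega

/-- Modulo an even number, consecutive differences of the zigzag sequence are distinct. -/
theorem zigzag_diff_cast_injOn {k a b : ℕ} (hk : Even k) (ha : a + 1 < k) (hb : b + 1 < k)
    (h : (zigzag (a + 1) : ZMod k) - zigzag a = zigzag (b + 1) - zigzag b) : a = b := by
  have hd (j : ℕ) : zigzag (j + 1) - zigzag j = if j % 2 = 0 then -(j : ℤ) - 1 else j + 1 := by
    unfold zigzag
    split_ifs <;> omega
  rw [← Int.cast_sub, ← Int.cast_sub, ZMod.intCast_eq_intCast_iff_dvd_sub, hd, hd] at h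
  have h2 : (2 : ℤ) ∣ k := by exact_mod_cast hk.two_dvd
  have h3 := h2.trans h
  have h0 := Int.eq_zero_of_abs_lt_dvd h
  rw [abs_lt] at h0
  split_ifs at h h0 h3 <;> omega

/-- The cyclic word `∞₀ z₀ ∞₁ z₁ … ∞ₓ₋₁ zₓ₋₁ zₓ … zₖ₋₁`, where `z` is the zigzag sequence
modulo `k`. -/
def zigzagWord (k x p : ℕ) : ZMod k ⊕ Fin x :=
  if h : p % 2 = 0 ∧ p < 2 * x then Sum.inr ⟨p / 2, by omega⟩
  else Sum.inl (zigzag (if p < 2 * x then p / 2 else p - x) : ZMod k)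

theorem zigzagWord_eq_inr {k x p : ℕ} {s : Fin x} (h : zigzagWord k x p = Sum.inr s) :
    p % 2 = 0 ∧ p < 2 * x := by
  unfold zigzagWord at h
  split_ifs at h with h1
  exact h1

theorem zigzagWord_eq_inl {k x p : ℕ} {a : ZMod k} (h : zigzagWord k x p = Sum.inl a) :
    ¬(p % 2 = 0 ∧ p < 2 * x) ∧
      a = (zigzag (if p < 2 * x then p / 2 else p - x) : ZMod k) := by
  unfold zigzagWord at h
  split at h
  · cases h
  · exact ⟨by assumption, (Sum.inl.inj h).symm⟩

theorem zigzagWord_injOn {k x p q : ℕ} (hx : x ≤ k) (hp : p < k + x) (hq : q < k + x)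
    (h : zigzagWord k x p = zigzagWord k x q) : p = q := by
  rcases hs : zigzagWord k x q with a | s
  · rw [hs] at h
    obtain ⟨h1, rfl⟩ := zigzagWord_eq_inl h
    obtain ⟨h2, h3⟩ := zigzagWord_eq_inl hs
    have := zigzag_cast_injOn (by split_ifs <;> omega) (by split_ifs <;> omega) h3
    split_ifs at this <;> omega
  · have h1 := zigzagWord_eq_inr (h.trans hs)
    have h2 := zigzagWord_eq_inr hs
    unfold zigzagWord at h
    rw [dif_pos h1, dif_pos h2, Sum.inr.injEq, Fin.mk.injEq] at h
    omega

theorem ZMod.val_add_one_cases {n : ℕ} [NeZero n] (hn : 1 < n) (u : ZMod n) :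
    (u.val + 1 < n ∧ (u + 1).val = u.val + 1) ∨ (u.val + 1 = n ∧ (u + 1).val = 0) := by
  have hu := u.val_lt
  have h : (u + 1).val = (u.val + 1) % n := by
    rw [ZMod.val_add, ZMod.val_one'' (by omega)]
  rcases Nat.lt_or_ge (u.val + 1) n with h1 | h1
  · exact Or.inl ⟨h1, by rw [h, Nat.mod_eq_of_lt h1]⟩
  · have h2 : u.val + 1 = n := by omega
    exact Or.inr ⟨h2, by rw [h, h2, Nat.mod_self]⟩

theorem bijective_zigzagWord_val {k x : ℕ} [NeZero k] (hx : x ≤ k) :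
    Function.Bijective (fun u : ZMod (k + x) => zigzagWord k x u.val) := by
  have : NeZero (k + x) := ⟨by have := NeZero.ne k; omega⟩
  rw [Fintype.bijective_iff_injective_and_card]
  exact ⟨fun u v h => ZMod.val_injective _
    (zigzagWord_injOn hx u.val_lt v.val_lt h), by simp [ZMod.card]⟩

theorem zigzagWord_succ_ne_inr {k x : ℕ} [NeZero k] (hx1 : 1 ≤ x) (hx : x ≤ k)
    {u : ZMod (k + x)} {s t : Fin x} (h : zigzagWord k x u.val = Sum.inr s) :
    zigzagWord k x (u + 1).val ≠ Sum.inr t := by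
  intro h'
  have : NeZero (k + x) := ⟨by omega⟩
  have h1 := zigzagWord_eq_inr h
  have h2 := zigzagWord_eq_inr h'
  rcases ZMod.val_add_one_cases (by omega) u with h3 | h3 <;> omega

theorem zigzagWord_inl_inl {k x : ℕ} [NeZero k] (hx1 : 1 ≤ x) (hx : x ≤ k)
    {u : ZMod (k + x)} {a b : ZMod k} (ha : zigzagWord k x u.val = Sum.inl a)
    (hb : zigzagWord k x (u + 1).val = Sum.inl b) :
    ∃ j, j + 1 < k ∧ u.val = j + x ∧ a = (zigzag j : ZMod k) ∧
      b = (zigzag (j + 1) : ZMod k) := by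
  have : NeZero (k + x) := ⟨by omega⟩
  obtain ⟨h1, rfl⟩ := zigzagWord_eq_inl ha
  obtain ⟨h2, rfl⟩ := zigzagWord_eq_inl hb
  rcases ZMod.val_add_one_cases (by omega) u with h3 | h3
  · rw [h3.2] at h2 ⊢
    refine ⟨u.val - x, by omega, by omega, ?_, ?_⟩
    · congr 2
      split_ifs <;> omega
    · congr 2
      split_ifs <;> omega
  · omega

theorem bddAbove_isDirLabeledPacking (n k : ℕ) [NeZero n] :
    BddAbove {p | ∃ f σ, IsDirLabeledPacking n k p f σ} := by
  refine ⟨n, ?_⟩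
  rintro p ⟨f, σ, hf, -⟩
  simpa [ZMod.card] using Fintype.card_le_of_surjective f hf

/-- A cyclic word over `ZMod k ⊕ Fin x` using every letter once, in which no two letters of
`Fin x` are adjacent and adjacent letters of `ZMod k` have pairwise distinct differences, yields
a packing by translating the letters of `ZMod k`. -/
theorem exists_isDirLabeledPacking_of_equiv {n k x : ℕ} [NeZero k] (hn : 1 < n)
    (c : ZMod n ≃ ZMod k ⊕ Fin x)
    (hc1 : ∀ u s t, c u = Sum.inr s → c (u + 1) ≠ Sum.inr t)
    (hc2 : ∀ u v a b a' b', c u = Sum.inl a → c (u + 1) = Sum.inl b →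
      c v = Sum.inl a' → c (v + 1) = Sum.inl b' → b - a = b' - a' → u = v) :
    ∃ f σ, IsDirLabeledPacking n k (x + 1) f σ := by
  have : Fact (1 < n) := ⟨hn⟩
  let τ (i : Fin k) : ZMod k ⊕ Fin x ≃ ZMod k ⊕ Fin x :=
    Equiv.sumCongr (Equiv.addRight ((i : ℕ) : ZMod k)) (Equiv.refl _)
  have hτl (i : Fin k) (a : ZMod k) : τ i (Sum.inl a) = Sum.inl (a + (i : ℕ)) := rfl
  have hτr (i : Fin k) (s : Fin x) : τ i (Sum.inr s) = Sum.inr s := rfl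
  have hcast (i j : Fin k) (h : ((i : ℕ) : ZMod k) = (j : ℕ)) : i = j := by
    have h' := congrArg ZMod.val h
    rw [ZMod.val_cast_of_lt i.2, ZMod.val_cast_of_lt j.2] at h'
    exact Fin.ext h'
  let label : ZMod k ⊕ Fin x → Fin (x + 1) := Sum.elim (fun _ => 0) Fin.succ
  have hlabel (i : Fin k) (w : ZMod k ⊕ Fin x) : label (τ i w) = label w := by
    rcases w with a | s <;> rfl
  refine ⟨fun v => label (c v), fun i => (c.trans (τ i)).trans c.symm, ?_, ⟨?_, ?_⟩, ?_⟩
  · refine Function.Surjective.comp (g := label) ?_ c.surjective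
    intro y
    refine Fin.cases ⟨Sum.inl 0, rfl⟩ (fun s => ⟨Sum.inr s, rfl⟩) y
  · rintro i _ ⟨v, rfl⟩ h
    simpa using ((c.trans (τ i)).trans c.symm).injective h
  · intro i j hij
    rw [Set.disjoint_left]
    rintro _ ⟨_, ⟨u, rfl⟩, rfl⟩ ⟨_, ⟨v, rfl⟩, h⟩
    simp only [Equiv.trans_apply, Prod.mk.injEq, EmbeddingLike.apply_eq_iff_eq] at h
    obtain ⟨h1, h2⟩ := h
    apply hij
    rcases hu : c u with a | s <;> rcases hv : c v with a' | s' <;>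
      rcases hu' : c (u + 1) with b | t <;> rcases hv' : c (v + 1) with b' | t' <;>
      simp only [hu, hv, hu', hv', hτl, hτr, Sum.inl.injEq, Sum.inr.injEq, reduceCtorEq] at h1 h2
    · have huv : u = v := hc2 u v a b a' b' hu hu' hv hv' (by linear_combination h1 - h2)
      subst huv
      obtain rfl : a = a' := Sum.inl.inj (hu.symm.trans hv)
      exact hcast i j (add_left_cancel h1).symm
    · subst h2
      have huv : u = v := add_right_cancel (c.injective (hu'.trans hv'.symm))
      subst huv
      obtain rfl : a = a' := Sum.inl.inj (hu.symm.trans hv)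
      exact hcast i j (add_left_cancel h1).symm
    · subst h1
      have huv : u = v := c.injective (hu.trans hv.symm)
      subst huv
      obtain rfl : b = b' := Sum.inl.inj (hu'.symm.trans hv')
      exact hcast i j (add_left_cancel h2).symm
    · exact absurd hu' (hc1 u s t hu)
  · intro i j v
    simp only [Equiv.trans_apply, Equiv.apply_symm_apply, hlabel]

/-- For every circuit `C⃗_n` of order `n = k + x`, with `k ≥ 2`, `k`
even, `1 ≤ x ≤ k − 1`, and `(x, n) ∉ {(1,4), (1,6)}`, we have `λ^k(C⃗_n) ≥ x + 1`. -/
theorem dirLabeledPackingNumber_ge_of_even (k x : ℕ) (hk : 2 ≤ k) (hke : Even k)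
    (hx1 : 1 ≤ x) (hx2 : x ≤ k - 1)
    (h4 : ¬(x = 1 ∧ k + x = 4)) (h6 : ¬(x = 1 ∧ k + x = 6)) :
    x + 1 ≤ dirLabeledPackingNumber (k + x) k := by
  have : NeZero k := ⟨by omega⟩
  have : NeZero (k + x) := ⟨by omega⟩
  have hx : x ≤ k := by omega
  refine le_csSup (bddAbove_isDirLabeledPacking _ _) ?_
  refine exists_isDirLabeledPacking_of_equiv (by omega)
    (Equiv.ofBijective _ (bijective_zigzagWord_val hx)) ?_ ?_
  · intro u s t h
    exact zigzagWord_succ_ne_inr hx1 hx h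
  · intro u v a b a' b' ha hb ha' hb' h
    obtain ⟨i, hi, hu, rfl, rfl⟩ := zigzagWord_inl_inl hx1 hx ha hb
    obtain ⟨j, hj, hv, rfl, rfl⟩ := zigzagWord_inl_inl hx1 hx ha' hb'
    have hij := zigzag_diff_cast_injOn hke hi hj h
    exact ZMod.val_injective _ (by omega)
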